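/- Let x¹,…,x^N ∈ ℝⁿ with N ≥ 1, let x̄ := (1/N) Σ_{r=1}^N x^r, let X := (1/N) Σ_{r=1}^N (x^r − x̄)(x^r − x̄)ᵀ with eigenvalues λ₁(X) ≥ … ≥ λ_n(X), and let 1 ≤ K ≤ n. Then the infimum over U, V ∈ ℝ^{n×K} with UᵀU = I_K and over c ∈ ℝⁿ of Σ_{r=1}^N ‖x^r − U Vᵀ x^r − c‖₂² equals Σ_{r=1}^N ‖x^r − x̄‖₂² − N Σ_{ℓ=1}^K λ_ℓ(X), and it is attained at U = V whose columns are orthonormal eigenvectors of X for the top K eigenvalues, together with c = (I − U Uᵀ) x̄. -/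

import Mathlib

open Finset Matrix

section OrthonormalColumns

variable {m k : Type*} [Fintype m] [Fintype k] [DecidableEq k]

/-- Completing the square around the orthogonal projection onto the column space of `U`. -/
theorem dotProduct_sub_mulVec_self {U : Matrix m k ℝ} (hU : Uᵀ * U = 1) (z : m → ℝ) (w : k → ℝ) :
    (z - U *ᵥ w) ⬝ᵥ (z - U *ᵥ w) =
      z ⬝ᵥ z - (Uᵀ *ᵥ z) ⬝ᵥ (Uᵀ *ᵥ z) + (w - Uᵀ *ᵥ z) ⬝ᵥ (w - Uᵀ *ᵥ z) := by
  have hzw : z ⬝ᵥ (U *ᵥ w) = (Uᵀ *ᵥ z) ⬝ᵥ w := by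
    rw [dotProduct_mulVec, mulVec_transpose]
  have hww : (U *ᵥ w) ⬝ᵥ (U *ᵥ w) = w ⬝ᵥ w := by
    rw [dotProduct_mulVec, ← mulVec_transpose, mulVec_mulVec, hU, one_mulVec]
  simp only [dotProduct_sub, sub_dotProduct]
  rw [dotProduct_comm (U *ᵥ w) z, hzw, hww, dotProduct_comm w (Uᵀ *ᵥ z)]
  ring

theorem transpose_mulVec_dotProduct_self_le {U : Matrix m k ℝ} (hU : Uᵀ * U = 1) (z : m → ℝ) :
    (Uᵀ *ᵥ z) ⬝ᵥ (Uᵀ *ᵥ z) ≤ z ⬝ᵥ z := by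
  have h := dotProduct_sub_mulVec_self hU z (Uᵀ *ᵥ z)
  rw [sub_self, zero_dotProduct, add_zero] at h
  have h0 : 0 ≤ (z - U *ᵥ (Uᵀ *ᵥ z)) ⬝ᵥ (z - U *ᵥ (Uᵀ *ᵥ z)) :=
    sum_nonneg fun _ _ => mul_self_nonneg _
  linarith

theorem sum_row_sq_le_one [DecidableEq m] {W : Matrix m k ℝ} (hW : Wᵀ * W = 1) (i : m) :
    ∑ l, W i l ^ 2 ≤ 1 := by
  simpa [dotProduct, sq, Pi.single_apply] using
    transpose_mulVec_dotProduct_self_le hW (Pi.single i 1)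

theorem sum_row_sq_eq_card {W : Matrix m k ℝ} (hW : Wᵀ * W = 1) :
    ∑ i, ∑ l, W i l ^ 2 = Fintype.card k := by
  have h := congrArg trace hW
  rw [trace_one] at h
  rw [← h, sum_comm]
  simp [trace, mul_apply, sq]

end OrthonormalColumns

/-- Centred vectors have least sum of squared distances to the origin. -/
theorem sum_dotProduct_self_le_sum_sub {m ι : Type*} [Fintype m] [Fintype ι] (z : ι → m → ℝ)
    (hz : ∑ r, z r = 0) (d : m → ℝ) :
    ∑ r, z r ⬝ᵥ z r ≤ ∑ r, (z r - d) ⬝ᵥ (z r - d) := by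
  have hzd : ∑ r, z r ⬝ᵥ d = 0 := by rw [← sum_dotProduct, hz, zero_dotProduct]
  have hd : 0 ≤ d ⬝ᵥ d := sum_nonneg fun _ _ => mul_self_nonneg _
  have h : ∑ r, (z r - d) ⬝ᵥ (z r - d) =
      ∑ r, z r ⬝ᵥ z r - 2 * ∑ r, z r ⬝ᵥ d + ∑ _r : ι, d ⬝ᵥ d := by
    rw [mul_sum, ← sum_sub_distrib, ← sum_add_distrib]
    refine sum_congr rfl fun r _ => ?_
    simp only [dotProduct_sub, sub_dotProduct]
    rw [dotProduct_comm d (z r)]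
    ring
  rw [h, hzd]
  have : 0 ≤ ∑ _r : ι, d ⬝ᵥ d := sum_nonneg fun _ _ => hd
  linarith

theorem sum_transpose_mulVec_dotProduct_self {m k ι : Type*} [Fintype m] [Fintype k] [Fintype ι]
    (U : Matrix m k ℝ) (y : ι → m → ℝ) :
    ∑ r, (Uᵀ *ᵥ y r) ⬝ᵥ (Uᵀ *ᵥ y r) = trace (Uᵀ * (∑ r, vecMulVec (y r) (y r)) * U) := by
  rw [Matrix.mul_sum, Matrix.sum_mul, trace_sum]
  refine sum_congr rfl fun r _ => ?_
  rw [mul_vecMulVec, vecMulVec_mul, trace_vecMulVec, mulVec_transpose]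

theorem trace_transpose_mul_diagonal_mul {m k : Type*} [Fintype m] [DecidableEq m] [Fintype k]
    (W : Matrix m k ℝ) (d : m → ℝ) :
    trace (Wᵀ * diagonal d * W) = ∑ i, d i * ∑ l, W i l ^ 2 := by
  simp only [trace, diag_apply, mul_apply (M := Wᵀ * diagonal d), mul_diagonal, transpose_apply,
    mul_sum]
  rw [sum_comm]
  exact sum_congr rfl fun i _ => sum_congr rfl fun l _ => by ring

/-- A sum of decreasing values with weights in `[0, 1]` of total mass `K` is at most the sum
of the `K` largest values. -/
theorem Antitone.sum_mul_le_sum_castLE {n K : ℕ} (hKn : K ≤ n) {lam : Fin n → ℝ}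
    (hmono : Antitone lam) {p : Fin n → ℝ} (hp0 : ∀ i, 0 ≤ p i) (hp1 : ∀ i, p i ≤ 1)
    (hpK : ∑ i, p i = K) :
    ∑ i, lam i * p i ≤ ∑ l : Fin K, lam (Fin.castLE hKn l) := by
  obtain ⟨j, rfl⟩ := Nat.exists_eq_add_of_le hKn
  rcases Nat.eq_zero_or_pos K with rfl | hK
  · have hp : ∀ i, p i = 0 := fun i =>
      (sum_eq_zero_iff_of_nonneg fun i _ => hp0 i).1 (by simpa using hpK) i (mem_univ i)
    simp [hp]
  · let t : Fin (K + j) := ⟨K - 1, by omega⟩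
    rw [Fin.sum_univ_add] at hpK ⊢
    have hlow : ∑ i : Fin K, (lam (Fin.castAdd j i) - lam t) * p (Fin.castAdd j i) ≤
        ∑ i : Fin K, (lam (Fin.castAdd j i) - lam t) :=
      sum_le_sum fun i _ => mul_le_of_le_one_right
        (sub_nonneg.2 (hmono (Fin.le_def.2 (by simp [t]; omega)))) (hp1 _)
    have hhigh : ∑ i : Fin j, (lam (Fin.natAdd K i) - lam t) * p (Fin.natAdd K i) ≤ 0 :=
      sum_nonpos fun i _ => mul_nonpos_of_nonpos_of_nonneg
        (sub_nonpos.2 (hmono (Fin.le_def.2 (by simp [t]; omega)))) (hp0 _)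
    simp only [sub_mul, sum_sub_distrib, ← mul_sum, sum_const, card_univ, Fintype.card_fin,
      nsmul_eq_mul] at hlow hhigh
    have hcast : ∀ l : Fin K, Fin.castLE hKn l = Fin.castAdd j l := fun _ => rfl
    simp only [hcast]
    linear_combination hlow + hhigh + lam t * hpK

/-- Ky Fan's maximum principle for an orthogonally diagonalised matrix. -/
theorem trace_transpose_mul_le_sum_castLE {n K : ℕ} (hKn : K ≤ n) {lam : Fin n → ℝ}
    (hmono : Antitone lam) {Q : Matrix (Fin n) (Fin n) ℝ} (hQ : Qᵀ * Q = 1)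
    {U : Matrix (Fin n) (Fin K) ℝ} (hU : Uᵀ * U = 1) :
    trace (Uᵀ * (Q * diagonal lam * Qᵀ) * U) ≤ ∑ l : Fin K, lam (Fin.castLE hKn l) := by
  have hW : (Qᵀ * U)ᵀ * (Qᵀ * U) = 1 := by
    rw [transpose_mul, transpose_transpose, Matrix.mul_assoc, ← Matrix.mul_assoc Q,
      mul_eq_one_comm.1 hQ, Matrix.one_mul, hU]
  have h : Uᵀ * (Q * diagonal lam * Qᵀ) * U = (Qᵀ * U)ᵀ * diagonal lam * (Qᵀ * U) := by
    simp only [transpose_mul, transpose_transpose, Matrix.mul_assoc]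
  rw [h, trace_transpose_mul_diagonal_mul]
  refine hmono.sum_mul_le_sum_castLE hKn (fun i => sum_nonneg fun _ _ => sq_nonneg _)
    (sum_row_sq_le_one hW) ?_
  simpa using sum_row_sq_eq_card hW

theorem trace_submatrix_transpose_mul {m k : Type*} [Fintype m] [DecidableEq m] [Fintype k]
    {Q : Matrix m m ℝ} (hQ : Qᵀ * Q = 1) (d : m → ℝ) (e : k → m) :
    trace ((Q.submatrix id e)ᵀ * (Q * diagonal d * Qᵀ) * Q.submatrix id e) = ∑ l, d (e l) := by
  have h : (Q.submatrix id e)ᵀ * (Q * diagonal d * Qᵀ) * Q.submatrix id e =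
      (Qᵀ * Q * diagonal d * (Qᵀ * Q)).submatrix e e := by
    simp only [Matrix.mul_assoc]
    rfl
  rw [h, hQ, Matrix.one_mul, Matrix.mul_one]
  simp [trace]

/-- The optimal rank-`K` affine autoencoder: the infimum over `U, V` with `UᵀU = I` and
`c` of `Σ_r ‖x^r − UVᵀx^r − c‖²` equals `Σ_r ‖x^r − x̄‖² − N Σ_{ℓ=1}^K λ_ℓ(X)`, attained
at `U = V` given by the top-`K` orthonormal eigenvectors of `X` (the first `K` columns of
an orthogonal `Q` diagonalising `X` with descending eigenvalues), with `c = (I − UUᵀ)x̄`. -/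
theorem optimal_rank_K_affine_autoencoder
    (n N K : ℕ) (hN : 1 ≤ N) (hK1 : 1 ≤ K) (hKn : K ≤ n)
    (x : Fin N → Fin n → ℝ)
    (xbar : Fin n → ℝ) (hxbar : xbar = (N : ℝ)⁻¹ • ∑ r, x r)
    (X : Matrix (Fin n) (Fin n) ℝ)
    (hX : X = (N : ℝ)⁻¹ • ∑ r, Matrix.vecMulVec (x r - xbar) (x r - xbar))
    (lam : Fin n → ℝ) (hmono : Antitone lam)
    (Q : Matrix (Fin n) (Fin n) ℝ) (hQ : Qᵀ * Q = 1)
    (hXQ : X = Q * Matrix.diagonal lam * Qᵀ) :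
    (∀ (U V : Matrix (Fin n) (Fin K) ℝ) (c : Fin n → ℝ), Uᵀ * U = 1 →
      (∑ r, ∑ j, (x r j - xbar j) ^ 2) - N * ∑ ℓ : Fin K, lam (Fin.castLE hKn ℓ)
        ≤ ∑ r, ∑ j, (x r j - (U * Vᵀ).mulVec (x r) j - c j) ^ 2) ∧
    ((Q.submatrix id (Fin.castLE hKn))ᵀ * (Q.submatrix id (Fin.castLE hKn)) = 1 ∧
      (∑ r, ∑ j, (x r j
          - ((Q.submatrix id (Fin.castLE hKn)) * (Q.submatrix id (Fin.castLE hKn))ᵀ).mulVec (x r) j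
          - (xbar - ((Q.submatrix id (Fin.castLE hKn)) * (Q.submatrix id (Fin.castLE hKn))ᵀ).mulVec xbar) j) ^ 2)
        = (∑ r, ∑ j, (x r j - xbar j) ^ 2) - N * ∑ ℓ : Fin K, lam (Fin.castLE hKn ℓ)) := by
  have hN0 : (N : ℝ) ≠ 0 := by positivity
  have hcentred : ∑ r, (x r - xbar) = 0 := by
    rw [sum_sub_distrib, hxbar, sum_const, card_univ, Fintype.card_fin, ← Nat.cast_smul_eq_nsmul ℝ,
      smul_smul, mul_inv_cancel₀ hN0, one_smul, sub_self]
  have hscatter : ∑ r, vecMulVec (x r - xbar) (x r - xbar) = (N : ℝ) • X := by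
    rw [hX, smul_smul, mul_inv_cancel₀ hN0, one_smul]
  have henergy : ∀ U : Matrix (Fin n) (Fin K) ℝ,
      ∑ r, (Uᵀ *ᵥ (x r - xbar)) ⬝ᵥ (Uᵀ *ᵥ (x r - xbar)) = N * trace (Uᵀ * X * U) := fun U => by
    rw [sum_transpose_mulVec_dotProduct_self, hscatter, Matrix.mul_smul, Matrix.smul_mul,
      trace_smul, smul_eq_mul]
  have hvar : ∑ r, ∑ j, (x r j - xbar j) ^ 2 = ∑ r, (x r - xbar) ⬝ᵥ (x r - xbar) := by
    simp [dotProduct, sq]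
  have hresidual : ∀ (U V : Matrix (Fin n) (Fin K) ℝ) (c : Fin n → ℝ),
      ∑ r, ∑ j, (x r j - (U * Vᵀ).mulVec (x r) j - c j) ^ 2 =
        ∑ r, ((x r - xbar - U *ᵥ (Vᵀ *ᵥ (x r - xbar))) - (c - (xbar - (U * Vᵀ) *ᵥ xbar))) ⬝ᵥ
          ((x r - xbar - U *ᵥ (Vᵀ *ᵥ (x r - xbar))) - (c - (xbar - (U * Vᵀ) *ᵥ xbar))) := by
    intro U V c
    refine sum_congr rfl fun r _ => sum_congr rfl fun j _ => ?_
    rw [mulVec_mulVec, mulVec_sub]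
    simp only [Pi.sub_apply]
    ring
  rw [hvar]
  refine ⟨fun U V c hU => ?_, ?_⟩
  · have hsum : ∑ r, (x r - xbar - U *ᵥ (Vᵀ *ᵥ (x r - xbar))) = 0 := by
      simp only [mulVec_mulVec]
      rw [sum_sub_distrib, ← mulVec_sum, hcentred, mulVec_zero, sub_zero]
    rw [hresidual]
    refine le_trans ?_ (sum_dotProduct_self_le_sum_sub _ hsum _)
    have hproj : ∑ r, ((x r - xbar) ⬝ᵥ (x r - xbar) -
        (Uᵀ *ᵥ (x r - xbar)) ⬝ᵥ (Uᵀ *ᵥ (x r - xbar))) ≤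
        ∑ r, (x r - xbar - U *ᵥ (Vᵀ *ᵥ (x r - xbar))) ⬝ᵥ
          (x r - xbar - U *ᵥ (Vᵀ *ᵥ (x r - xbar))) :=
      sum_le_sum fun r _ => by
        rw [dotProduct_sub_mulVec_self hU]
        exact le_add_of_nonneg_right (sum_nonneg fun _ _ => mul_self_nonneg _)
    refine le_trans ?_ hproj
    rw [sum_sub_distrib, henergy, hXQ]
    gcongr
    exact trace_transpose_mul_le_sum_castLE hKn hmono hQ hU
  · have hU : (Q.submatrix id (Fin.castLE hKn))ᵀ * Q.submatrix id (Fin.castLE hKn) = 1 := by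
      have h : (Q.submatrix id (Fin.castLE hKn))ᵀ * Q.submatrix id (Fin.castLE hKn) =
          (Qᵀ * Q).submatrix (Fin.castLE hKn) (Fin.castLE hKn) := rfl
      rw [h, hQ, submatrix_one _ (Fin.castLE_injective hKn)]
    refine ⟨hU, ?_⟩
    rw [hresidual, sub_self]
    simp only [sub_zero, dotProduct_sub_mulVec_self hU, sub_self, zero_dotProduct, add_zero]
    rw [sum_sub_distrib, henergy, hXQ, trace_submatrix_transpose_mul hQ]
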